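/- arXiv:1103.4684 — 5 statements merged into one kernel-verified Lean document; each statement's English description precedes it below -/
import Mathlib

section
/- Fix integers M ≥ 1 and n ≥ 1 and random vectors γ_1, …, γ_n in ℝ^M with nonnegative coordinates on a probability space. Let A_1, …, A_n ⊆ ℝ^M be Borel sets and τ_1 ∈ ℝ. Set X = γ_{1,1}, Y = max_{2≤i≤n} γ_{i,1}·1{γ_i ∈ A_i} (with Y = 0 when no user i ≥ 2 requests beam 1), let r = log(1 + max(X·1{γ_1 ∈ A_1}, Y)) be the beam-1 rate under (A_1, A_2, …, A_n), and let r¹ = log(1 + max(X·1{X ≥ τ_1}, Y)) be the beam-1 rate under ({x : x_1 ≥ τ_1}, A_2, …, A_n). Then the loss event {ω : r¹(ω) < r(ω)} is exactly equal to the event {ω : γ_1(ω) ∈ A_1 and γ_{1,1}(ω) < τ_1 and Y(ω) < γ_{1,1}(ω)}. -/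
open MeasureTheory ProbabilityTheory

/-- **Lemma 1.** Characterization of the loss event incurred when user 1 switches
from feedback set `A 0` to the threshold rule `{x | τ₁ ≤ x 1}`. -/
theorem loss_event_characterization
    {Ω : Type*} [MeasureSpace Ω] [IsProbabilityMeasure (ℙ : Measure Ω)]
    (M n : ℕ) (hM : 0 < M) (hn : 0 < n)
    (γ : Fin n → Ω → Fin M → ℝ)
    (hnonneg : ∀ i ω k, 0 ≤ γ i ω k)
    (A : Fin n → Set (Fin M → ℝ)) (hA : ∀ i, MeasurableSet (A i))
    (τ₁ : ℝ)
    (X Y : Ω → ℝ)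
    (hX : X = fun ω => γ ⟨0, hn⟩ ω ⟨0, hM⟩)
    (hY : Y = fun ω => ⨆ i : {j : Fin n // j ≠ ⟨0, hn⟩},
      (A i.1).indicator (fun x => x ⟨0, hM⟩) (γ i.1 ω))
    (r r1 : Ω → ℝ)
    (hr : r = fun ω => Real.log (1 +
      max ((A ⟨0, hn⟩).indicator (fun x => x ⟨0, hM⟩) (γ ⟨0, hn⟩ ω)) (Y ω)))
    (hr1 : r1 = fun ω => Real.log (1 +
      max ({x : Fin M → ℝ | τ₁ ≤ x ⟨0, hM⟩}.indicator (fun x => x ⟨0, hM⟩) (γ ⟨0, hn⟩ ω)) (Y ω))) :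
    {ω | r1 ω < r ω}
      = {ω | γ ⟨0, hn⟩ ω ∈ A ⟨0, hn⟩ ∧ X ω < τ₁ ∧ Y ω < X ω} := by
  ext ω
  have hx : 0 ≤ γ ⟨0, hn⟩ ω ⟨0, hM⟩ := hnonneg _ _ _
  have hy : 0 ≤ Y ω := by
    rw [hY]
    refine Real.iSup_nonneg fun i => ?_
    by_cases h : γ i.1 ω ∈ A i.1
    · simpa [h] using hnonneg i.1 ω ⟨0, hM⟩
    · simp [h]
  have log_lt_iff (a b : ℝ) : Real.log (1 + max a (Y ω)) < Real.log (1 + max b (Y ω)) ↔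
      max a (Y ω) < max b (Y ω) := by
    have ha := le_max_right a (Y ω)
    have hb := le_max_right b (Y ω)
    rw [Real.log_lt_log_iff (by linarith) (by linarith), add_lt_add_iff_left]
  simp only [Set.mem_ofPred_eq, hr, hr1, hX, log_lt_iff]
  by_cases hmem : γ ⟨0, hn⟩ ω ∈ A ⟨0, hn⟩ <;>
    by_cases hτ : τ₁ ≤ γ ⟨0, hn⟩ ω ⟨0, hM⟩ <;>
    simp [Set.indicator, hmem, hτ, hy] <;> grind
end

section
/- Fix integers M ≥ 1 and n ≥ 1 and random vectors γ_1, …, γ_n in ℝ^M with nonnegative coordinates on a probability space. Let A_1, …, A_n ⊆ ℝ^M be Borel sets and τ_1 ∈ ℝ. Set X = γ_{1,1}, Y = max_{2≤i≤n} γ_{i,1}·1{γ_i ∈ A_i} (with Y = 0 when no user i ≥ 2 requests beam 1), let r = log(1 + max(X·1{γ_1 ∈ A_1}, Y)) be the beam-1 rate under (A_1, A_2, …, A_n), and let r¹ = log(1 + max(X·1{X ≥ τ_1}, Y)) be the beam-1 rate under ({x : x_1 ≥ τ_1}, A_2, …, A_n). Then the gain event {ω : r¹(ω) > r(ω)} is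 exactly equal to the event {ω : γ_1(ω) ∉ A_1 and γ_{1,1}(ω) ≥ τ_1 and Y(ω) < γ_{1,1}(ω)}. -/
open MeasureTheory ProbabilityTheory

/-- **Lemma 2.** Characterization of the gain event obtained when user 1 switches
from feedback set `A 0` to the threshold rule `{x | τ₁ ≤ x 1}`. -/
theorem gain_event_characterization
    {Ω : Type*} [MeasureSpace Ω] [IsProbabilityMeasure (ℙ : Measure Ω)]
    (M n : ℕ) (hM : 0 < M) (hn : 0 < n)
    (γ : Fin n → Ω → Fin M → ℝ)
    (hnonneg : ∀ i ω k, 0 ≤ γ i ω k)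
    (A : Fin n → Set (Fin M → ℝ)) (hA : ∀ i, MeasurableSet (A i))
    (τ₁ : ℝ)
    (X Y : Ω → ℝ)
    (hX : X = fun ω => γ ⟨0, hn⟩ ω ⟨0, hM⟩)
    (hY : Y = fun ω => ⨆ i : {j : Fin n // j ≠ ⟨0, hn⟩},
      (A i.1).indicator (fun x => x ⟨0, hM⟩) (γ i.1 ω))
    (r r1 : Ω → ℝ)
    (hr : r = fun ω => Real.log (1 +
      max ((A ⟨0, hn⟩).indicator (fun x => x ⟨0, hM⟩) (γ ⟨0, hn⟩ ω)) (Y ω)))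
    (hr1 : r1 = fun ω => Real.log (1 +
      max ({x : Fin M → ℝ | τ₁ ≤ x ⟨0, hM⟩}.indicator (fun x => x ⟨0, hM⟩) (γ ⟨0, hn⟩ ω)) (Y ω))) :
    {ω | r ω < r1 ω}
      = {ω | γ ⟨0, hn⟩ ω ∉ A ⟨0, hn⟩ ∧ τ₁ ≤ X ω ∧ Y ω < X ω} := by
  ext ω
  have hYω : 0 ≤ Y ω := by
    rw [hY]
    exact Real.iSup_nonneg fun i => Set.indicator_apply_nonneg fun _ => hnonneg _ _ _
  have hXω : γ ⟨0, hn⟩ ω ⟨0, hM⟩ = X ω := by rw [hX]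
  have hpos : ∀ a : ℝ, 0 < 1 + max a (Y ω) := fun a => by
    linarith [le_max_right a (Y ω)]
  simp only [Set.mem_ofPred_eq, hr, hr1]
  rw [Real.log_lt_log_iff (hpos _) (hpos _), add_lt_add_iff_left]
  by_cases h₁ : γ ⟨0, hn⟩ ω ∈ A ⟨0, hn⟩ <;> by_cases h₂ : τ₁ ≤ X ω <;>
    simp [h₁, h₂, hXω, hYω]
end

section
/- Let γ be a random vector in ℝ^M (M ≥ 1) with nonnegative coordinates on a probability space, write X = γ_1 for its first coordinate, and assume log(1 + X) is integrable. Let A ⊆ ℝ^M be a Borel set and τ ∈ ℝ satisfy ℙ(X ≥ τ) = ℙ(γ ∈ A). Then for every constant y ≥ 0, E[log(1 + max(X·1{X ≥ τ}, y))] ≥ E[log(1 + max(X·1{γ ∈ A}, y))]. -/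
open MeasureTheory ProbabilityTheory

theorem integrable_log_one_add_max {Ω : Type*} [MeasurableSpace Ω] {μ : Measure Ω}
    [IsFiniteMeasure μ] {f X : Ω → ℝ} (hf : Measurable f) (hf0 : ∀ ω, 0 ≤ f ω)
    (hfX : ∀ ω, f ω ≤ X ω) (hX : Integrable (fun ω => Real.log (1 + X ω)) μ)
    {y : ℝ} (hy : 0 ≤ y) :
    Integrable (fun ω => Real.log (1 + max (f ω) y)) μ := by
  refine (hX.add (integrable_const (Real.log (1 + y)))).mono'
    ((hf.max measurable_const).const_add 1).log.aestronglyMeasurable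
    (Filter.Eventually.of_forall fun ω => ?_)
  have hfω := hf0 ω
  have hXω := hfX ω
  have hlogX : 0 ≤ Real.log (1 + X ω) := Real.log_nonneg (by linarith)
  have hlogy : 0 ≤ Real.log (1 + y) := Real.log_nonneg (by linarith)
  rw [Real.norm_of_nonneg (Real.log_nonneg (by linarith [le_max_right (f ω) y]))]
  simp only [Pi.add_apply]
  rcases le_total (f ω) y with h | h
  · rw [max_eq_right h]
    linarith
  · rw [max_eq_left h]
    linarith [Real.log_le_log (by linarith : 0 < 1 + f ω) (by linarith : 1 + f ω ≤ 1 + X ω)]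

theorem log_one_add_max_mono {a b y : ℝ} (hy : 0 ≤ y) (hab : a ≤ b) :
    Real.log (1 + max a y) ≤ Real.log (1 + max b y) :=
  Real.log_le_log (by linarith [le_max_right a y]) (by gcongr)

/-- **Conditional-rate inequality.** Conditioned on the best beam-1 SINR `y` of
the other users, switching a user from feedback set `A` to the
feedback-level-matched threshold rule never decreases the expected beam-1
rate. -/
theorem conditional_rate_threshold_switch
    {Ω : Type*} [MeasureSpace Ω] [IsProbabilityMeasure (ℙ : Measure Ω)]
    (M : ℕ) (hM : 0 < M)
    (γ : Ω → Fin M → ℝ)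
    (hmeas : Measurable γ)
    (hnonneg : ∀ ω k, 0 ≤ γ ω k)
    (X : Ω → ℝ) (hX : X = fun ω => γ ω ⟨0, hM⟩)
    (hint : Integrable (fun ω => Real.log (1 + X ω)) ℙ)
    (A : Set (Fin M → ℝ)) (hA : MeasurableSet A)
    (τ : ℝ)
    (hτ : ℙ {ω | τ ≤ X ω} = ℙ {ω | γ ω ∈ A})
    (y : ℝ) (hy : 0 ≤ y) :
    (∫ ω, Real.log (1 +
        max ({x : Fin M → ℝ | τ ≤ x ⟨0, hM⟩}.indicator (fun x => x ⟨0, hM⟩) (γ ω)) y) ∂ℙ)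
      ≥ ∫ ω, Real.log (1 + max (A.indicator (fun x => x ⟨0, hM⟩) (γ ω)) y) ∂ℙ := by
  set B : Set (Fin M → ℝ) := {x | τ ≤ x ⟨0, hM⟩}
  have hB : MeasurableSet B := measurableSet_le measurable_const (measurable_pi_apply _)
  have hrate (S : Set (Fin M → ℝ)) (hS : MeasurableSet S) :
      Integrable
        (fun ω => Real.log (1 + max (S.indicator (fun x => x ⟨0, hM⟩) (γ ω)) y)) ℙ := by
    refine integrable_log_one_add_max (((measurable_pi_apply _).indicator hS).comp hmeas)
      (fun ω => Set.indicator_apply_nonneg fun _ => hnonneg ω _) (fun ω => ?_) hint hy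
    rw [hX]
    exact Set.indicator_apply_le' (fun _ => le_rfl) (fun _ => hnonneg ω _)
  set c := Real.log (1 + max τ y) - Real.log (1 + y)
  have hpen (S : Set (Fin M → ℝ)) (hS : MeasurableSet S) :
      Integrable ((γ ⁻¹' S).indicator fun _ => c) ℙ :=
    (integrable_const c).indicator (hmeas hS)
  have hpen_eq : ∫ ω, (γ ⁻¹' B).indicator (fun _ => c) ω ∂ℙ
      = ∫ ω, (γ ⁻¹' A).indicator (fun _ => c) ω ∂ℙ := by
    have hμ : ℙ (γ ⁻¹' B) = ℙ (γ ⁻¹' A) := by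
      rw [hX] at hτ
      exact hτ
    rw [integral_indicator_const _ (hmeas hB), integral_indicator_const _ (hmeas hA),
      measureReal_def, measureReal_def, hμ]
  have key := integral_mono ((hrate A hA).add (hpen B hB)) ((hrate B hB).add (hpen A hA))
    fun ω => by
      have hB_iff : γ ω ∈ B ↔ τ ≤ γ ω ⟨0, hM⟩ := Iff.rfl
      by_cases hωA : γ ω ∈ A <;> by_cases hωB : γ ω ∈ B <;>
        simp only [Pi.add_apply, Set.indicator, Set.mem_preimage, hωA, hωB, if_true, if_false,
          max_eq_right hy, le_refl]
      · have := log_one_add_max_mono hy (not_le.mp (hB_iff.not.mp hωB)).le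
        linarith
      · have := log_one_add_max_mono hy (hB_iff.mp hωB)
        linarith
  rw [integral_add' (hrate A hA) (hpen B hB), integral_add' (hrate B hB) (hpen A hA)] at key
  linarith
end

section
/- Let X be a nonnegative real random variable on a probability space with log(1 + X) integrable. Let A ⊆ ℝ be a Borel set and τ ∈ ℝ satisfy ℙ(X ≥ τ) = ℙ(X ∈ A). Then E[log(1 + X)·1{X ≥ τ}] ≥ E[log(1 + X)·1{X ∈ A}]. -/
open MeasureTheory ProbabilityTheory

/-- If `f` is at least `c` on `T` and at most `c` off `T`, then `T` maximizes `∫ f` among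
the measurable sets of the same measure. -/
theorem setIntegral_le_setIntegral_of_measure_eq {Ω : Type*} [MeasurableSpace Ω]
    {μ : Measure Ω} [IsFiniteMeasure μ] {f : Ω → ℝ} (hf : Integrable f μ) {S T : Set Ω}
    (hS : MeasurableSet S) (hT : MeasurableSet T) (hST : μ T = μ S) {c : ℝ}
    (hcT : ∀ ω ∈ T, c ≤ f ω) (hcT' : ∀ ω ∉ T, f ω ≤ c) :
    ∫ ω in S, f ω ∂μ ≤ ∫ ω in T, f ω ∂μ := by
  have hg : Integrable (fun ω => f ω - c) μ := hf.sub (integrable_const c)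
  have key : ∫ ω in S, (f ω - c) ∂μ ≤ ∫ ω in T, (f ω - c) ∂μ := by
    rw [← integral_indicator hS, ← integral_indicator hT]
    refine integral_mono (hg.indicator hS) (hg.indicator hT) fun ω => ?_
    by_cases hωS : ω ∈ S <;> by_cases hωT : ω ∈ T <;> simp [hωS, hωT]
    · exact hcT' ω hωT
    · exact hcT ω hωT
  rw [integral_sub hf.integrableOn (integrable_const c),
    integral_sub hf.integrableOn (integrable_const c), setIntegral_const, setIntegral_const,
    measureReal_def, measureReal_def, hST] at key
  linarith

/-- **Single-user single-beam optimality of thresholding.** Among all feedback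
sets with a prescribed feedback probability, the upper-threshold set maximizes
the expected achieved rate `log (1 + X)`. -/
theorem single_user_threshold_optimal
    {Ω : Type*} [MeasureSpace Ω] [IsProbabilityMeasure (ℙ : Measure Ω)]
    (X : Ω → ℝ) (hmeas : Measurable X) (hnonneg : ∀ ω, 0 ≤ X ω)
    (hint : Integrable (fun ω => Real.log (1 + X ω)) ℙ)
    (A : Set ℝ) (hA : MeasurableSet A)
    (τ : ℝ)
    (hτ : ℙ {ω | τ ≤ X ω} = ℙ {ω | X ω ∈ A}) :
    (∫ ω in {ω | τ ≤ X ω}, Real.log (1 + X ω) ∂ℙ)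
      ≥ ∫ ω in {ω | X ω ∈ A}, Real.log (1 + X ω) ∂ℙ := by
  refine setIntegral_le_setIntegral_of_measure_eq hint (hmeas hA)
    (measurableSet_le measurable_const hmeas) hτ (c := Real.log (1 + max τ 0)) ?_ ?_
  · intro ω hω
    have h : max τ 0 ≤ X ω := max_le hω (hnonneg ω)
    gcongr
  · intro ω hω
    have h : X ω ≤ max τ 0 := (not_le.mp hω).le.trans (le_max_left _ _)
    have := hnonneg ω
    gcongr
end

section
/- Let X be a real random variable on a probability space, let B be a measurable event, and let τ ∈ ℝ satisfy ℙ(B) = ℙ(X ≥ τ). Let f : ℝ → ℝ be nondecreasing with f(X) integrable. Then E[f(X)·1{X ≥ τ}] ≥ E[f(X)·1_B]. -/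
open MeasureTheory ProbabilityTheory

/-- **Abstract monotone-thresholding principle.** If an event `B` has the same
probability as the threshold event `{τ ≤ X}`, then for any nondecreasing
integrable reward `f (X ·)`, replacing `B` by the threshold event cannot
decrease the expected reward. -/
theorem monotone_thresholding_principle
    {Ω : Type*} [MeasureSpace Ω] [IsProbabilityMeasure (ℙ : Measure Ω)]
    (X : Ω → ℝ) (hmeas : Measurable X)
    (B : Set Ω) (hB : MeasurableSet B)
    (τ : ℝ)
    (hτ : ℙ B = ℙ {ω | τ ≤ X ω})
    (f : ℝ → ℝ) (hf : Monotone f)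
    (hint : Integrable (fun ω => f (X ω)) ℙ) :
    (∫ ω in {ω | τ ≤ X ω}, f (X ω) ∂ℙ) ≥ ∫ ω in B, f (X ω) ∂ℙ := by
  have hA : MeasurableSet {ω | τ ≤ X ω} := measurableSet_le measurable_const hmeas
  have hg : Integrable (fun ω => f (X ω) - f τ) ℙ := hint.sub (integrable_const _)
  have excess (S : Set Ω) : ∫ ω in S, (f (X ω) - f τ) ∂ℙ
      = (∫ ω in S, f (X ω) ∂ℙ) - (ℙ : Measure Ω).real S * f τ := by
    rw [integral_sub hint.integrableOn (integrable_const _), setIntegral_const, smul_eq_mul]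
  have h : ∫ ω in B, (f (X ω) - f τ) ∂ℙ ≤ ∫ ω in {ω | τ ≤ X ω}, (f (X ω) - f τ) ∂ℙ := by
    rw [← integral_indicator hB, ← integral_indicator hA]
    refine integral_mono (hg.indicator hB) (hg.indicator hA) fun ω => ?_
    by_cases hω : τ ≤ X ω
    · rw [Set.indicator_of_mem (s := {ω | τ ≤ X ω}) hω]
      exact Set.indicator_apply_le' (fun _ => le_rfl) fun _ => sub_nonneg.2 (hf hω)
    · rw [Set.indicator_of_notMem (s := {ω | τ ≤ X ω}) hω]
      exact Set.indicator_apply_le' (fun _ => sub_nonpos.2 (hf (not_le.1 hω).le)) fun _ => le_rfl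
  have hreal : (ℙ : Measure Ω).real B = (ℙ : Measure Ω).real {ω | τ ≤ X ω} := by
    rw [measureReal_def, measureReal_def, hτ]
  rw [excess, excess, hreal] at h
  linarith
end
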